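/- For every p ∈ [0,1], if there exists a natural number n with T_n(p) < 1/2, then lim_{n→∞} T_n(p) = 0. -/

import Mathlib

open Set Filter Topology

noncomputable section

/-- The dyadic tile `[a/2^i, (a+1)/2^i] × [b/2^j, (b+1)/2^j]` as a subset of `ℝ × ℝ`. -/
def dyadicTile (i j a b : ℕ) : Set (ℝ × ℝ) :=
  Set.Icc ((a : ℝ) / 2 ^ i) (((a : ℝ) + 1) / 2 ^ i) ×ˢ
    Set.Icc ((b : ℝ) / 2 ^ j) (((b : ℝ) + 1) / 2 ^ j)

/-- `t` is a dyadic tile of order `n` contained in the unit square. -/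
def IsDyadicTile (n : ℕ) (t : Set (ℝ × ℝ)) : Prop :=
  ∃ i j a b : ℕ, i + j = n ∧ a < 2 ^ i ∧ b < 2 ^ j ∧ t = dyadicTile i j a b

/-- `F` is a tiling of the region `R` by dyadic tiles of order `n`:
a set of order-`n` tiles whose union is `R` and whose interiors are pairwise disjoint. -/
def IsTiling (n : ℕ) (F : Set (Set (ℝ × ℝ))) (R : Set (ℝ × ℝ)) : Prop :=
  (∀ t ∈ F, IsDyadicTile n t) ∧ ⋃₀ F = R ∧
    F.Pairwise fun s t => interior s ∩ interior t = ∅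

def unitSquare : Set (ℝ × ℝ) := Set.Icc (0 : ℝ) 1 ×ˢ Set.Icc (0 : ℝ) 1

/-- Index type for the dyadic tiles of order `n`: a shape `i` (width `2^{-i}`, height
`2^{-(n-i)}`) together with the horizontal and vertical positions. -/
abbrev TileIndex (n : ℕ) : Type :=
  Σ i : Fin (n + 1), Fin (2 ^ (i : ℕ)) × Fin (2 ^ (n - (i : ℕ)))

/-- The order-`n` tile corresponding to an index. -/
def tileOf (n : ℕ) (x : TileIndex n) : Set (ℝ × ℝ) :=
  dyadicTile (x.1 : ℕ) (n - (x.1 : ℕ)) (x.2.1 : ℕ) (x.2.2 : ℕ)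

/-- The set `S` of available order-`n` tiles admits a tiling of the unit square. -/
def TileableSquare (n : ℕ) (S : Finset (TileIndex n)) : Prop :=
  ∃ F : Set (Set (ℝ × ℝ)), (∀ t ∈ F, ∃ x ∈ S, t = tileOf n x) ∧ IsTiling n F unitSquare

open Classical in
/-- Probability of the event `E` when each of the `(n+1)·2^n` order-`n` dyadic tiles is
available independently with probability `p`. -/
def Pr (n : ℕ) (p : ℝ) (E : Finset (TileIndex n) → Prop) : ℝ :=
  ∑ S : Finset (TileIndex n),
    if E S then p ^ S.card * (1 - p) ^ ((n + 1) * 2 ^ n - S.card) else 0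

/-- `T n p`: the probability that some set of available order-`n` tiles tiles `[0,1]²`. -/
def T (n : ℕ) (p : ℝ) : ℝ := Pr n p (TileableSquare n)

/-- The critical probability `p_c`. -/
def pc : ℝ :=
  sInf {p : ℝ | p ∈ Set.Icc (0 : ℝ) 1 ∧ Tendsto (fun n => T n p) atTop (𝓝 1)}

section RandomSubset

open Classical in
/-- Probability of the event `E` for a random subset of a finite type, each element being
present independently with probability `p`. -/
def subsetProb (α : Type*) [Fintype α] (p : ℝ) (E : Finset α → Prop) : ℝ :=
  ∑ S : Finset α, if E S then p ^ S.card * (1 - p) ^ (Fintype.card α - S.card) else 0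

variable {α β : Type*} [Fintype α] [Fintype β] {p : ℝ}

theorem subsetProb_nonneg (hp : p ∈ Set.Icc (0 : ℝ) 1) (E : Finset α → Prop) :
    0 ≤ subsetProb α p E := by
  have h1 : 0 ≤ 1 - p := by linarith [hp.2]
  have h0 := hp.1
  refine Finset.sum_nonneg fun S _ => ?_
  split_ifs <;> positivity

theorem subsetProb_le_add (hp : p ∈ Set.Icc (0 : ℝ) 1) {E E₁ E₂ : Finset α → Prop}
    (h : ∀ S, E S → E₁ S ∨ E₂ S) :
    subsetProb α p E ≤ subsetProb α p E₁ + subsetProb α p E₂ := by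
  have h1 : 0 ≤ 1 - p := by linarith [hp.2]
  have h0 := hp.1
  unfold subsetProb
  rw [← Finset.sum_add_distrib]
  refine Finset.sum_le_sum fun S _ => ?_
  have hw : 0 ≤ p ^ S.card * (1 - p) ^ (Fintype.card α - S.card) := by positivity
  have := h S
  split_ifs <;> first | linarith | tauto

theorem subsetProb_true (α : Type*) [Fintype α] (p : ℝ) :
    subsetProb α p (fun _ => True) = 1 := by
  simp [subsetProb, Fintype.sum_pow_mul_eq_add_pow]

theorem subsetProb_sum (E : Finset α → Prop) (E' : Finset β → Prop) :
    subsetProb (α ⊕ β) p (fun S => E S.toLeft ∧ E' S.toRight) =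
      subsetProb α p E * subsetProb β p E' := by
  unfold subsetProb
  rw [Finset.sum_mul_sum, ← Finset.sum_product', Finset.univ_product_univ]
  refine Fintype.sum_equiv Finset.sumEquiv.toEquiv _ _ fun S => ?_
  have hS : S.card = S.toLeft.card + S.toRight.card := S.card_toLeft_add_card_toRight.symm
  have hl : S.toLeft.card ≤ Fintype.card α := Finset.card_le_univ _
  have hr : S.toRight.card ≤ Fintype.card β := Finset.card_le_univ _
  have hsub : Fintype.card (α ⊕ β) - S.card =
      (Fintype.card α - S.toLeft.card) + (Fintype.card β - S.toRight.card) := by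
    rw [Fintype.card_sum]; omega
  by_cases h : E S.toLeft <;> by_cases h' : E' S.toRight <;> simp [h, h']
  rw [← Fintype.card_sum, hsub, hS, pow_add, pow_add]
  ring

theorem subsetProb_congr_equiv (e : α ≃ β) (E : Finset α → Prop) :
    subsetProb β p (fun S => E (S.map e.symm.toEmbedding)) = subsetProb α p E := by
  unfold subsetProb
  refine Fintype.sum_equiv e.symm.finsetCongr _ _ fun S => ?_
  simp only [Equiv.finsetCongr_apply, Finset.card_map, Fintype.card_congr e]
  congr

open Classical in
theorem subsetProb_comap {e : α → β} (he : Function.Injective e) (E : Finset α → Prop) :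
    subsetProb β p (fun S => E {x | e x ∈ S}) = subsetProb α p E := by
  let f : α ⊕ ↥(Set.range e)ᶜ ≃ β :=
    (Equiv.sumCongr (Equiv.ofInjective e he) (Equiv.refl _)).trans (Equiv.Set.sumCompl _)
  have hf (x : α) : f (Sum.inl x) = e x := rfl
  have key := subsetProb_congr_equiv (p := p) f (fun S => E S.toLeft ∧ True)
  rw [subsetProb_sum E (fun _ => True), subsetProb_true, mul_one] at key
  rw [← key]
  congr 1
  funext S
  have : ({x | e x ∈ S} : Finset α) = (S.map f.symm.toEmbedding).toLeft := by
    ext x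
    simp only [Finset.mem_filter_univ, Finset.mem_toLeft, Finset.mem_map_equiv, Equiv.symm_symm, hf]
  simp [this]

open Classical in
theorem subsetProb_comap_and_comap {e₁ e₂ : α → β} (h₁ : Function.Injective e₁)
    (h₂ : Function.Injective e₂) (h : ∀ x y, e₁ x ≠ e₂ y) (E : Finset α → Prop) :
    subsetProb β p (fun S => E {x | e₁ x ∈ S} ∧ E {x | e₂ x ∈ S}) = subsetProb α p E ^ 2 := by
  rw [sq, ← subsetProb_sum, ← subsetProb_comap (h₁.sumElim h₂ h)]
  congr 1
  funext S
  congr 2 <;> · ext x; simp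

end RandomSubset

theorem card_tileIndex (n : ℕ) : Fintype.card (TileIndex n) = (n + 1) * 2 ^ n := by
  have (i : Fin (n + 1)) : 2 ^ (i : ℕ) * 2 ^ (n - (i : ℕ)) = 2 ^ n := by
    rw [← pow_add]; congr 1; omega
  simp [Fintype.card_sigma, this]

theorem T_eq_subsetProb (n : ℕ) (p : ℝ) :
    T n p = subsetProb (TileIndex n) p (TileableSquare n) := by
  simp only [T, Pr, subsetProb, card_tileIndex]

theorem tileIndex_ext {n : ℕ} {x y : TileIndex n} (hi : (x.1 : ℕ) = y.1)
    (ha : (x.2.1 : ℕ) = y.2.1) (hb : (x.2.2 : ℕ) = y.2.2) : x = y := by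
  obtain ⟨⟨i, hi'⟩, ⟨a, ha'⟩, ⟨b, hb'⟩⟩ := x
  obtain ⟨⟨j, hj'⟩, ⟨a', ha''⟩, ⟨b', hb''⟩⟩ := y
  dsimp only at hi ha hb
  subst hi ha hb
  rfl

theorem interior_dyadicTile (i j a b : ℕ) : interior (dyadicTile i j a b) =
    Set.Ioo ((a : ℝ) / 2 ^ i) (((a : ℝ) + 1) / 2 ^ i) ×ˢ
      Set.Ioo ((b : ℝ) / 2 ^ j) (((b : ℝ) + 1) / 2 ^ j) := by
  rw [dyadicTile, interior_prod_eq, interior_Icc, interior_Icc]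

theorem dyadicTile_subset_unitSquare {i j a b : ℕ} (ha : a < 2 ^ i) (hb : b < 2 ^ j) :
    dyadicTile i j a b ⊆ unitSquare := by
  have ha' : (a : ℝ) + 1 ≤ 2 ^ i := by exact_mod_cast ha
  have hb' : (b : ℝ) + 1 ≤ 2 ^ j := by exact_mod_cast hb
  refine Set.prod_mono (Set.Icc_subset_Icc (by positivity) ?_)
    (Set.Icc_subset_Icc (by positivity) ?_)
  · exact (div_le_one (by positivity)).2 ha'
  · exact (div_le_one (by positivity)).2 hb'

theorem tileOf_subset_unitSquare {n : ℕ} (x : TileIndex n) : tileOf n x ⊆ unitSquare :=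
  dyadicTile_subset_unitSquare x.2.1.2 x.2.2.2

theorem isDyadicTile_tileOf {n : ℕ} (x : TileIndex n) : IsDyadicTile n (tileOf n x) :=
  ⟨x.1, n - x.1, x.2.1, x.2.2, by omega, x.2.1.2, x.2.2.2, rfl⟩

theorem isClosed_tileOf {n : ℕ} (x : TileIndex n) : IsClosed (tileOf n x) :=
  isClosed_Icc.prod isClosed_Icc

open Classical in
/-- A tiling of the square restricts to a tiling of a sub-rectangle `φ '' unitSquare`, provided
that the tiles of the tiling meeting the interior of the sub-rectangle are images under `φ` of
tiles of order `n`. -/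
theorem TileableSquare.comap {n m : ℕ} (e : TileIndex n → TileIndex m)
    (φ : ℝ × ℝ ≃ₜ ℝ × ℝ) (hφ : ∀ z ∈ unitSquare, φ z ∈ unitSquare)
    (he : ∀ x, φ ⁻¹' tileOf m (e x) = tileOf n x)
    {S : Finset (TileIndex m)} {F : Set (Set (ℝ × ℝ))}
    (hS : ∀ t ∈ F, ∃ x ∈ S, t = tileOf m x) (hF : IsTiling m F unitSquare)
    (hsurj : ∀ w, tileOf m w ∈ F → ∀ z ∈ Set.Ioo (0 : ℝ) 1 ×ˢ Set.Ioo (0 : ℝ) 1,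
      φ z ∈ tileOf m w → ∃ x, w = e x) :
    TileableSquare n {x | e x ∈ S} := by
  obtain ⟨-, hU, hdisj⟩ := hF
  let A : Set (TileIndex n) := {x | e x ∈ S ∧ tileOf m (e x) ∈ F}
  refine ⟨tileOf n '' A, ?_, ?_, ?_, ?_⟩
  · rintro _ ⟨x, hx, rfl⟩
    exact ⟨x, by simpa using hx.1, rfl⟩
  · rintro _ ⟨x, -, rfl⟩
    exact isDyadicTile_tileOf x
  · rw [Set.sUnion_image]
    refine Set.Subset.antisymm (Set.iUnion₂_subset fun x _ => tileOf_subset_unitSquare x) ?_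
    have hclosed : IsClosed (⋃ x ∈ A, tileOf n x) :=
      A.toFinite.isClosed_biUnion fun x _ => isClosed_tileOf x
    have hdense : unitSquare = closure (Set.Ioo (0 : ℝ) 1 ×ˢ Set.Ioo (0 : ℝ) 1) := by
      rw [closure_prod_eq, closure_Ioo zero_ne_one, unitSquare]
    rw [hdense]
    refine closure_minimal (fun z hz => ?_) hclosed
    have hz' : φ z ∈ ⋃₀ F := hU ▸ hφ z (hdense ▸ subset_closure hz)
    obtain ⟨t, ht, hzt⟩ := hz'
    obtain ⟨w, hw, rfl⟩ := hS t ht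
    obtain ⟨x, rfl⟩ := hsurj w ht z hz hzt
    refine Set.mem_biUnion (x := x) ⟨hw, ht⟩ ?_
    rw [← he]
    exact hzt
  · rintro _ ⟨x, hx, rfl⟩ _ ⟨y, hy, rfl⟩ hxy
    rw [← he, ← he] at hxy ⊢
    have hne : tileOf m (e x) ≠ tileOf m (e y) := fun h => hxy (by rw [h])
    rw [← φ.preimage_interior, ← φ.preimage_interior, ← Set.preimage_inter,
      hdisj hx.2 hy.2 hne, Set.preimage_empty]

/-- The tile indices of order `n + 1` in the left (`c = 0`) or right (`c = 1`) half. -/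
def horizontalHalf {n : ℕ} (c : Fin 2) (x : TileIndex n) : TileIndex (n + 1) :=
  ⟨⟨x.1 + 1, by omega⟩,
    ⟨x.2.1 + c * 2 ^ (x.1 : ℕ), by
      have := x.2.1.2
      have : (c : ℕ) * 2 ^ (x.1 : ℕ) ≤ 1 * 2 ^ (x.1 : ℕ) := Nat.mul_le_mul_right _ (by omega)
      change _ < 2 ^ ((x.1 : ℕ) + 1)
      rw [pow_succ]; omega⟩,
    ⟨x.2.2, by simp⟩⟩

/-- The tile indices of order `n + 1` in the lower (`c = 0`) or upper (`c = 1`) half. -/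
def verticalHalf {n : ℕ} (c : Fin 2) (x : TileIndex n) : TileIndex (n + 1) :=
  ⟨⟨x.1, by omega⟩, x.2.1,
    ⟨x.2.2 + c * 2 ^ (n - (x.1 : ℕ)), by
      have := x.2.2.2
      have : (c : ℕ) * 2 ^ (n - (x.1 : ℕ)) ≤ 1 * 2 ^ (n - (x.1 : ℕ)) :=
        Nat.mul_le_mul_right _ (by omega)
      have h : n + 1 - (x.1 : ℕ) = n - x.1 + 1 := by omega
      change _ < 2 ^ (n + 1 - (x.1 : ℕ))
      rw [h, pow_succ]; omega⟩⟩

theorem horizontalHalf_injective {n : ℕ} (c : Fin 2) :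
    Function.Injective (horizontalHalf (n := n) c) := by
  intro x y h
  have hi : (x.1 : ℕ) = y.1 := by
    have := congrArg (fun w : TileIndex (n + 1) => (w.1 : ℕ)) h
    simpa [horizontalHalf, Fin.ext_iff] using this
  refine tileIndex_ext hi ?_ (congrArg (fun w : TileIndex (n + 1) => (w.2.2 : ℕ)) h)
  have := congrArg (fun w : TileIndex (n + 1) => (w.2.1 : ℕ)) h
  simpa [horizontalHalf, hi] using this

theorem verticalHalf_injective {n : ℕ} (c : Fin 2) :
    Function.Injective (verticalHalf (n := n) c) := by
  intro x y h
  have hi : (x.1 : ℕ) = y.1 := congrArg (fun w : TileIndex (n + 1) => (w.1 : ℕ)) h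
  refine tileIndex_ext hi (congrArg (fun w : TileIndex (n + 1) => (w.2.1 : ℕ)) h) ?_
  have := congrArg (fun w : TileIndex (n + 1) => (w.2.2 : ℕ)) h
  simpa [verticalHalf, hi] using this

theorem horizontalHalf_zero_ne_one {n : ℕ} (x y : TileIndex n) :
    horizontalHalf 0 x ≠ horizontalHalf 1 y := by
  intro h
  have hi : (x.1 : ℕ) = y.1 := by
    have := congrArg (fun w : TileIndex (n + 1) => (w.1 : ℕ)) h
    simpa [horizontalHalf, Fin.ext_iff] using this
  have := congrArg (fun w : TileIndex (n + 1) => (w.2.1 : ℕ)) h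
  have hx := x.2.1.2
  simp only [horizontalHalf, Fin.val_zero, Fin.val_one, hi] at this hx
  omega

theorem verticalHalf_zero_ne_one {n : ℕ} (x y : TileIndex n) :
    verticalHalf 0 x ≠ verticalHalf 1 y := by
  intro h
  have hi : (x.1 : ℕ) = y.1 := congrArg (fun w : TileIndex (n + 1) => (w.1 : ℕ)) h
  have := congrArg (fun w : TileIndex (n + 1) => (w.2.2 : ℕ)) h
  have hx := x.2.2.2
  simp only [verticalHalf, Fin.val_zero, Fin.val_one, hi] at this hx
  omega

theorem exists_eq_horizontalHalf {n : ℕ} {w : TileIndex (n + 1)} (hw : (w.1 : ℕ) ≠ 0) :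
    ∃ c x, w = horizontalHalf c x := by
  obtain ⟨⟨i, hi⟩, ⟨a, ha⟩, ⟨b, hb⟩⟩ := w
  dsimp only at hw ha hb
  obtain ⟨i, rfl⟩ := Nat.exists_eq_succ_of_ne_zero hw
  rw [Nat.succ_eq_add_one, pow_succ] at ha
  have hb' : b < 2 ^ (n - i) := by simpa using hb
  by_cases h : a < 2 ^ i
  · exact ⟨0, ⟨⟨i, by omega⟩, ⟨a, h⟩, ⟨b, hb'⟩⟩,
      tileIndex_ext rfl (by simp [horizontalHalf]) rfl⟩
  · exact ⟨1, ⟨⟨i, by omega⟩, ⟨a - 2 ^ i, by change _ < 2 ^ i; omega⟩, ⟨b, hb'⟩⟩,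
      tileIndex_ext rfl (by simp [horizontalHalf]; omega) rfl⟩

theorem exists_eq_verticalHalf {n : ℕ} {w : TileIndex (n + 1)} (hw : (w.1 : ℕ) ≠ n + 1) :
    ∃ c x, w = verticalHalf c x := by
  obtain ⟨⟨i, hi⟩, ⟨a, ha⟩, ⟨b, hb⟩⟩ := w
  dsimp only at hw ha hb
  have hsub : n + 1 - i = n - i + 1 := by omega
  rw [hsub, pow_succ] at hb
  by_cases h : b < 2 ^ (n - i)
  · exact ⟨0, ⟨⟨i, by omega⟩, ⟨a, ha⟩, ⟨b, h⟩⟩,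
      tileIndex_ext rfl rfl (by simp [verticalHalf])⟩
  · exact ⟨1, ⟨⟨i, by omega⟩, ⟨a, ha⟩, ⟨b - 2 ^ (n - i), by change _ < 2 ^ (n - i); omega⟩⟩,
      tileIndex_ext rfl rfl (by simp [verticalHalf]; omega)⟩

/-- The affine map of the line taking `[0,1]` to `[c/2, (c+1)/2]`. -/
def halfScale (c : ℝ) : ℝ ≃ₜ ℝ where
  toFun x := (x + c) / 2
  invFun x := 2 * x - c
  left_inv x := by ring
  right_inv x := by ring
  continuous_toFun := by fun_prop
  continuous_invFun := by fun_prop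

theorem halfScale_mem_dyadicInterval (c a i : ℕ) (x : ℝ) :
    halfScale c x ∈ Set.Icc (((a + c * 2 ^ i : ℕ) : ℝ) / 2 ^ (i + 1))
        ((((a + c * 2 ^ i : ℕ) : ℝ) + 1) / 2 ^ (i + 1)) ↔
      x ∈ Set.Icc ((a : ℝ) / 2 ^ i) (((a : ℝ) + 1) / 2 ^ i) := by
  have h : (0 : ℝ) < 2 ^ i := by positivity
  have h' : (0 : ℝ) < 2 ^ (i + 1) := by positivity
  change (x + c) / 2 ∈ _ ↔ _
  rw [Set.mem_Icc, Set.mem_Icc, div_le_iff₀ h', le_div_iff₀ h', div_le_iff₀ h, le_div_iff₀ h,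
    pow_succ]
  push_cast
  constructor <;> rintro ⟨h1, h2⟩ <;> constructor <;> nlinarith

theorem halfScale_mem_unitInterval (c : Fin 2) {x : ℝ} (hx : x ∈ Set.Icc (0 : ℝ) 1) :
    halfScale (c : ℕ) x ∈ Set.Icc (0 : ℝ) 1 := by
  change (x + (c : ℕ)) / 2 ∈ _
  obtain ⟨h0, h1⟩ := hx
  fin_cases c <;> constructor <;> simp <;> linarith

theorem eq_of_halfScale_eq {c d : Fin 2} {x y : ℝ} (hx : x ∈ Set.Ioo (0 : ℝ) 1)
    (hy : y ∈ Set.Icc (0 : ℝ) 1) (h : halfScale (c : ℕ) x = halfScale (d : ℕ) y) : d = c := by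
  change (x + (c : ℕ)) / 2 = (y + (d : ℕ)) / 2 at h
  obtain ⟨h0, h1⟩ := hx
  obtain ⟨h2, h3⟩ := hy
  fin_cases c <;> fin_cases d <;> simp at h ⊢ <;> linarith

/-- The map taking the unit square onto its left or right half. -/
def horizontalScale (c : Fin 2) : ℝ × ℝ ≃ₜ ℝ × ℝ :=
  (halfScale (c : ℕ)).prodCongr (Homeomorph.refl ℝ)

/-- The map taking the unit square onto its lower or upper half. -/
def verticalScale (c : Fin 2) : ℝ × ℝ ≃ₜ ℝ × ℝ :=
  (Homeomorph.refl ℝ).prodCongr (halfScale (c : ℕ))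

theorem preimage_tileOf_horizontalHalf {n : ℕ} (c : Fin 2) (x : TileIndex n) :
    horizontalScale c ⁻¹' tileOf (n + 1) (horizontalHalf c x) = tileOf n x := by
  ext ⟨u, v⟩
  refine and_congr (halfScale_mem_dyadicInterval c _ _ u) ?_
  simp [horizontalHalf, horizontalScale]

theorem preimage_tileOf_verticalHalf {n : ℕ} (c : Fin 2) (x : TileIndex n) :
    verticalScale c ⁻¹' tileOf (n + 1) (verticalHalf c x) = tileOf n x := by
  ext ⟨u, v⟩
  have hsub : n + 1 - (x.1 : ℕ) = n - x.1 + 1 := by omega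
  refine and_congr Iff.rfl ?_
  have := halfScale_mem_dyadicInterval c x.2.2 (n - (x.1 : ℕ)) v
  rw [← hsub] at this
  exact this

open Classical in
theorem TileableSquare.horizontalHalf {n : ℕ} {S : Finset (TileIndex (n + 1))}
    {F : Set (Set (ℝ × ℝ))} (hS : ∀ t ∈ F, ∃ x ∈ S, t = tileOf (n + 1) x)
    (hF : IsTiling (n + 1) F unitSquare) (h : ∀ w, tileOf (n + 1) w ∈ F → (w.1 : ℕ) ≠ 0)
    (c : Fin 2) : TileableSquare n {x | _root_.horizontalHalf c x ∈ S} := by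
  refine TileableSquare.comap _ (horizontalScale c)
    (fun z hz => ⟨halfScale_mem_unitInterval c hz.1, hz.2⟩)
    (preimage_tileOf_horizontalHalf c) hS hF fun w hw z hz hzw => ?_
  obtain ⟨d, x, rfl⟩ := exists_eq_horizontalHalf (h w hw)
  obtain ⟨z', hz'⟩ := (horizontalScale d).surjective (horizontalScale c z)
  rw [← hz', ← Set.mem_preimage, preimage_tileOf_horizontalHalf] at hzw
  have := eq_of_halfScale_eq hz.1 (tileOf_subset_unitSquare x hzw).1
    (congrArg Prod.fst hz').symm
  exact ⟨x, by rw [this]⟩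

open Classical in
theorem TileableSquare.verticalHalf {n : ℕ} {S : Finset (TileIndex (n + 1))}
    {F : Set (Set (ℝ × ℝ))} (hS : ∀ t ∈ F, ∃ x ∈ S, t = tileOf (n + 1) x)
    (hF : IsTiling (n + 1) F unitSquare) (h : ∀ w, tileOf (n + 1) w ∈ F → (w.1 : ℕ) ≠ n + 1)
    (c : Fin 2) : TileableSquare n {x | _root_.verticalHalf c x ∈ S} := by
  refine TileableSquare.comap _ (verticalScale c)
    (fun z hz => ⟨hz.1, halfScale_mem_unitInterval c hz.2⟩)
    (preimage_tileOf_verticalHalf c) hS hF fun w hw z hz hzw => ?_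
  obtain ⟨d, x, rfl⟩ := exists_eq_verticalHalf (h w hw)
  obtain ⟨z', hz'⟩ := (verticalScale d).surjective (verticalScale c z)
  rw [← hz', ← Set.mem_preimage, preimage_tileOf_verticalHalf] at hzw
  have := eq_of_halfScale_eq hz.2 (tileOf_subset_unitSquare x hzw).2
    (congrArg Prod.snd hz').symm
  exact ⟨x, by rw [this]⟩

theorem dyadicTile_zero_left_ne_zero_right {m a b : ℕ} (hm : m ≠ 0) :
    dyadicTile 0 m 0 b ≠ dyadicTile m 0 a 0 := by
  intro h
  have h2 : (1 : ℝ) < 2 ^ m := one_lt_pow₀ (by norm_num) hm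
  have hb : (b : ℝ) / 2 ^ m ≤ ((b : ℝ) + 1) / 2 ^ m := by gcongr; linarith
  have h0 : ((0 : ℝ), (b : ℝ) / 2 ^ m) ∈ dyadicTile m 0 a 0 := by
    rw [← h]; simp [dyadicTile, hb]
  have h1 : ((1 : ℝ), (b : ℝ) / 2 ^ m) ∈ dyadicTile m 0 a 0 := by
    rw [← h]; simp [dyadicTile, hb]
  have e0 := h0.1.1
  have e1 := h1.1.2
  dsimp only at e0 e1
  rw [div_le_iff₀ (by positivity)] at e0
  rw [le_div_iff₀ (by positivity)] at e1
  linarith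

theorem interior_dyadicTile_inter_nonempty {m a b : ℕ} (ha : a < 2 ^ m) (hb : b < 2 ^ m) :
    (interior (dyadicTile 0 m 0 b) ∩ interior (dyadicTile m 0 a 0)).Nonempty := by
  have hp : (0 : ℝ) < 2 ^ m := by positivity
  have ha' : (a : ℝ) + 1 ≤ 2 ^ m := by exact_mod_cast ha
  have hb' : (b : ℝ) + 1 ≤ 2 ^ m := by exact_mod_cast hb
  have ha0 : (0 : ℝ) ≤ a := a.cast_nonneg
  have hb0 : (0 : ℝ) ≤ b := b.cast_nonneg
  refine ⟨(((a : ℝ) + 1 / 2) / 2 ^ m, ((b : ℝ) + 1 / 2) / 2 ^ m), ?_⟩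
  rw [interior_dyadicTile, interior_dyadicTile]
  simp only [Set.mem_inter_iff, Set.mem_prod, Set.mem_Ioo, Nat.cast_zero, pow_zero, zero_add,
    div_one]
  refine ⟨⟨⟨by positivity, ?_⟩, ?_, ?_⟩, ⟨?_, ?_⟩, by positivity, ?_⟩
  all_goals first
    | (rw [div_lt_one hp]; linarith)
    | (gcongr; linarith)

theorem IsTiling.horizontal_or_vertical {n : ℕ} {F : Set (Set (ℝ × ℝ))}
    (hF : IsTiling (n + 1) F unitSquare) :
    (∀ w, tileOf (n + 1) w ∈ F → (w.1 : ℕ) ≠ 0) ∨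
      (∀ w, tileOf (n + 1) w ∈ F → (w.1 : ℕ) ≠ n + 1) := by
  by_contra! hcon
  obtain ⟨⟨⟨⟨i, hi⟩, ⟨a, ha⟩, ⟨b, hb⟩⟩, hw, hw0⟩,
    ⟨⟨⟨j, hj⟩, ⟨a', ha'⟩, ⟨b', hb'⟩⟩, hv, hv0⟩⟩ := hcon
  dsimp only at hw0 hv0 ha hb ha' hb'
  subst hw0 hv0
  obtain rfl : a = 0 := by simpa using ha
  obtain rfl : b' = 0 := by simpa using hb'
  simp only [tileOf, Nat.sub_zero, Nat.sub_self] at hw hv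
  have := hF.2.2 hw hv (dyadicTile_zero_left_ne_zero_right n.succ_ne_zero)
  exact (interior_dyadicTile_inter_nonempty ha' hb).ne_empty this

theorem T_nonneg {p : ℝ} (hp : p ∈ Set.Icc (0 : ℝ) 1) (n : ℕ) : 0 ≤ T n p := by
  rw [T_eq_subsetProb]
  exact subsetProb_nonneg hp _

theorem T_succ_le {p : ℝ} (hp : p ∈ Set.Icc (0 : ℝ) 1) (n : ℕ) :
    T (n + 1) p ≤ 2 * T n p ^ 2 := by
  classical
  rw [T_eq_subsetProb, T_eq_subsetProb, two_mul]
  nth_rw 1 [← subsetProb_comap_and_comap (horizontalHalf_injective 0)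
    (horizontalHalf_injective 1) horizontalHalf_zero_ne_one]
  rw [← subsetProb_comap_and_comap (verticalHalf_injective 0)
    (verticalHalf_injective 1) verticalHalf_zero_ne_one]
  refine subsetProb_le_add hp ?_
  rintro S ⟨F, hS, hF⟩
  refine hF.horizontal_or_vertical.imp (fun h => ?_) fun h => ?_
  · convert And.intro (TileableSquare.horizontalHalf hS hF h 0)
      (TileableSquare.horizontalHalf hS hF h 1)
  · convert And.intro (TileableSquare.verticalHalf hS hF h 0)
      (TileableSquare.verticalHalf hS hF h 1)

theorem tendsto_zero_of_succ_le_two_mul_sq {u : ℕ → ℝ} (h0 : ∀ n, 0 ≤ u n)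
    (hu : ∀ n, u (n + 1) ≤ 2 * u n ^ 2) {n : ℕ} (hn : u n < 1 / 2) :
    Tendsto u atTop (𝓝 0) := by
  have hr0 : 0 ≤ 2 * u n := by linarith [h0 n]
  have hr1 : 2 * u n < 1 := by linarith
  have hbound (k : ℕ) : u (k + n) ≤ u n * (2 * u n) ^ k := by
    induction k with
    | zero => simp
    | succ k ih =>
      have hk : (2 * u n) ^ k ≤ 1 := pow_le_one₀ hr0 hr1.le
      have hnn := h0 n
      calc u (k + 1 + n) = u (k + n + 1) := by congr 1; omega
        _ ≤ 2 * u (k + n) ^ 2 := hu _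
        _ ≤ 2 * (u n * (2 * u n) ^ k) ^ 2 := by gcongr; exact h0 _
        _ = u n * (2 * u n) ^ (k + 1) * (2 * u n) ^ k := by ring
        _ ≤ u n * (2 * u n) ^ (k + 1) := mul_le_of_le_one_right (by positivity) hk
  rw [← tendsto_add_atTop_iff_nat n]
  refine squeeze_zero (fun k => h0 _) hbound ?_
  simpa using (tendsto_pow_atTop_nhds_zero_of_lt_one hr0 hr1).const_mul (u n)

/-- if `T_n(p) < 1/2` for some `n`, then `T_n(p) → 0`. -/
theorem tendsto_zero_of_lt_half (p : ℝ) (hp : p ∈ Set.Icc (0 : ℝ) 1)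
    (h : ∃ n : ℕ, T n p < 1 / 2) :
    Tendsto (fun n => T n p) atTop (𝓝 0) := by
  obtain ⟨n, hn⟩ := h
  exact tendsto_zero_of_succ_le_two_mul_sq (T_nonneg hp) (T_succ_le hp) hn

end
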